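/- Let k ≥ 3, let g = 2s+1 ≥ 7 be odd, set nc(k,g) = k(k−1)^s/2, and let ε be an integer with 0 < ε ≤ (k−1)/2. Then there is no integer n for which a vgr(n, k, g, nc(k,g) − ε)-graph exists. -/

import Mathlib

open SimpleGraph

/-- The number of closed walks based at `u` of length `g` that are cycles.
Since each (unoriented, basepoint-free) cycle of length `g ≥ 3` through `u`
corresponds to exactly two such closed walks (one for each orientation), this
equals twice the number of cycles of length `g` containing `u`. -/
noncomputable def vertexCycleCount {V : Type*} (G : SimpleGraph V) (g : ℕ) (u : V) : ℕ :=
  Nat.card {p : G.Walk u u // p.IsCycle ∧ p.length = g}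

/-- `IsVGR G v k g lam` says that `G` is a vertex-girth-regular
`vgr(v,k,g,lam)`-graph: a finite simple `k`-regular graph of girth `g` on `v`
vertices in which every vertex lies on exactly `lam` cycles of length `g`
(encoded as: `2 * lam` closed cycle-walks based at each vertex). -/
def IsVGR {V : Type*} (G : SimpleGraph V) (v k g lam : ℕ) : Prop :=
  Finite V ∧ Nat.card V = v ∧ (∀ u : V, Nat.card (G.neighborSet u) = k) ∧
    G.girth = (g : ℕ∞) ∧ ∀ u : V, vertexCycleCount G g u = 2 * lam

namespace SimpleGraph

variable {V : Type*} {G : SimpleGraph V} {u x y z : V} {i : ℕ}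

lemma Walk.edist_le_length_of_mem_support {p : G.Walk u x} (hz : z ∈ p.support) :
    G.edist u z ≤ p.length := by
  classical
  exact (edist_le (p.takeUntil z hz)).trans (mod_cast p.length_takeUntil_le_length hz)

lemma exists_isPath_of_edist_eq (h : G.edist u x = i) :
    ∃ p : G.Walk u x, p.IsPath ∧ p.length = i := by
  classical
  obtain ⟨p, hp⟩ := exists_walk_of_edist_eq_coe h
  refine ⟨p.bypass, p.bypass_isPath, le_antisymm (hp ▸ p.length_bypass_le_length) ?_⟩
  exact_mod_cast h ▸ edist_le p.bypass

lemma edist_le_add_one (h : G.Adj x y) : G.edist u y ≤ G.edist u x + 1 := by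
  simpa [edist_eq_one_iff_adj.2 h] using G.edist_triangle (u := u) (v := x) (w := y)

/-- Below the girth, paths with the same endpoints coincide. -/
lemma Walk.IsPath.eq_of_length_add_lt_egirth {p q : G.Walk u x} (hp : p.IsPath) (hq : q.IsPath)
    (hg : (p.length + q.length : ℕ) < G.egirth) : p = q := by
  by_contra hne
  obtain ⟨w, -, -, c, hc, hl⟩ := hp.exists_isCycle_length_le_add_of_ne hq hne
  exact (hg.trans_le (egirth_le_length hc)).not_ge (mod_cast hl)

lemma Walk.IsPath.edist_eq_length {p : G.Walk u x} (hp : p.IsPath)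
    (hg : (2 * p.length : ℕ) < G.egirth) : G.edist u x = p.length := by
  have hle := edist_le p
  obtain ⟨n, hn⟩ := ENat.ne_top_iff_exists.1 (ne_top_of_le_ne_top (ENat.natCast_ne_top _) hle)
  obtain ⟨q, hq, hql⟩ := exists_isPath_of_edist_eq hn.symm
  rw [← hn, Nat.cast_le] at hle
  rw [← hn, ← hql, hp.eq_of_length_add_lt_egirth hq (lt_of_le_of_lt (mod_cast by lia) hg)]

lemma not_adj_of_edist_eq (hx : G.edist u x = i) (hy : G.edist u y = i)
    (hg : (2 * i + 1 : ℕ) < G.egirth) : ¬ G.Adj x y := by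
  intro h
  obtain ⟨p, hp, hpl⟩ := exists_isPath_of_edist_eq hx
  obtain ⟨q, hq, hql⟩ := exists_isPath_of_edist_eq hy
  have hyp : y ∉ p.support := fun hyp ↦ by
    classical
    have hl := p.length_takeUntil_lt_length hyp h.ne'
    have := edist_le (p.takeUntil y hyp)
    rw [hy, Nat.cast_le] at this
    lia
  have := (hp.concat hyp h).eq_of_length_add_lt_egirth hq
    (lt_of_le_of_lt (mod_cast by simp; lia) hg)
  have := congrArg Walk.length this
  simp at this
  lia

lemma eq_of_adj_of_edist_eq (hx : G.edist u x = (i + 1 : ℕ)) (hy : G.edist u y = i)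
    (hz : G.edist u z = i) (hyx : G.Adj y x) (hzx : G.Adj z x)
    (hg : (2 * (i + 1) : ℕ) < G.egirth) : y = z := by
  obtain ⟨p, hp, hpl⟩ := exists_isPath_of_edist_eq hy
  obtain ⟨q, hq, hql⟩ := exists_isPath_of_edist_eq hz
  have aux {w} (r : G.Walk u w) (hr : r.length = i) : x ∉ r.support := fun hm ↦ by
    have := Walk.edist_le_length_of_mem_support hm
    rw [hx, Nat.cast_le] at this
    lia
  have := (hp.concat (aux p hpl) hyx).eq_of_length_add_lt_egirth (hq.concat (aux q hql) hzx)
    (lt_of_le_of_lt (mod_cast by simp; lia) hg)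
  simpa using congrArg Walk.penultimate this

/-- The closed walk through `x` and `y` closing up two walks from `u` along the edge `xy`. -/
abbrev Walk.closeUp (p : G.Walk u x) (h : G.Adj x y) (q : G.Walk u y) : G.Walk u u :=
  p.append (q.concat h.symm).reverse

lemma Walk.IsPath.isCycle_closeUp (hx : G.edist u x = i) (hy : G.edist u y = i)
    (hg : (2 * i : ℕ) < G.egirth) (hi : i ≠ 0) {p : G.Walk u x} (hp : p.IsPath)
    (hpl : p.length = i) (h : G.Adj x y) {q : G.Walk u y} (hq : q.IsPath) (hql : q.length = i) :
    (p.closeUp h q).IsCycle := by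
  classical
  have key (z) (hzp : z ∈ p.support) (hzq : z ∈ q.support) : z = u := by
    by_contra hzu
    have hpz := (congrArg Walk.length (p.take_spec hzp)).symm
    have hqz := (congrArg Walk.length (q.take_spec hzq)).symm
    rw [Walk.length_append] at hpz hqz
    have heq := (hp.takeUntil hzp).eq_of_length_add_lt_egirth (hq.takeUntil hzq)
      (lt_of_le_of_lt (mod_cast by lia) hg)
    have hpos : (p.takeUntil z hzp).length ≠ 0 := fun h0 ↦
      hzu (Walk.eq_of_length_eq_zero h0).symm
    have hlen := congrArg Walk.length heq
    have hx' := (hp.dropUntil hzp).edist_eq_length (lt_of_le_of_lt (mod_cast by lia) hg)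
    have hy' := (hq.dropUntil hzq).edist_eq_length (lt_of_le_of_lt (mod_cast by lia) hg)
    rw [show (q.dropUntil z hzq).length = (p.dropUntil z hzp).length by lia] at hy'
    exact not_adj_of_edist_eq hx' hy' (lt_of_le_of_lt (mod_cast by lia) hg) h
  have hxu : x ≠ u := by
    rintro rfl
    rw [edist_self] at hx
    exact hi (by exact_mod_cast hx.symm)
  have hxq : x ∉ q.support := fun hm ↦ hxu (key x p.end_mem_support hm)
  refine hp.isCycle_append (hq.concat hxq h.symm).reverse (fun z hz hz' ↦ ?_) (.inr (by simp; lia))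
  have hzu := key z (List.mem_of_mem_tail hz) (by simpa using hz')
  subst hzu
  have := hp.support_nodup
  rw [← p.cons_tail_support, List.nodup_cons] at this
  exact this.1 hz

variable [Fintype V]

open Classical in
/-- The vertices at distance exactly `i` from `u`. -/
noncomputable def distSphere (G : SimpleGraph V) (u : V) (i : ℕ) : Finset V :=
  {x | G.edist u x = i}

open Classical in
/-- The vertices at distance at most `i` from `u`. -/
noncomputable def distBall (G : SimpleGraph V) (u : V) (i : ℕ) : Finset V :=
  {x | G.edist u x ≤ i}

@[simp] lemma mem_distSphere : x ∈ G.distSphere u i ↔ G.edist u x = i := by simp [distSphere]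

@[simp] lemma mem_distBall : x ∈ G.distBall u i ↔ G.edist u x ≤ i := by simp [distBall]

variable [DecidableRel G.Adj]

lemma vertexCycleCount_eq_card_interedges {s : ℕ} (hs : s ≠ 0)
    (hg : (2 * s : ℕ) < G.egirth) (u : V) :
    vertexCycleCount G (2 * s + 1) u = (G.interedges (G.distSphere u s) (G.distSphere u s)).card := by
  classical
  rw [vertexCycleCount, ← Nat.card_eq_finsetCard]
  symm
  have hm (e : G.interedges (G.distSphere u s) (G.distSphere u s)) :
      G.edist u e.1.1 = s ∧ G.edist u e.1.2 = s ∧ G.Adj e.1.1 e.1.2 := by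
    obtain ⟨h₁, h₂, h₃⟩ := (mem_interedges_iff G).1 e.2
    exact ⟨mem_distSphere.1 h₁, mem_distSphere.1 h₂, h₃⟩
  choose p hp hpl using fun e ↦ exists_isPath_of_edist_eq (hm e).1
  choose q hq hql using fun e ↦ exists_isPath_of_edist_eq (hm e).2.1
  refine Nat.card_congr (.ofBijective (fun e ↦ ⟨(p e).closeUp (hm e).2.2 (q e),
    (hp e).isCycle_closeUp (hm e).1 (hm e).2.1 hg hs (hpl e) (hm e).2.2 (hq e) (hql e),
    by simp [hpl, hql]; lia⟩) ⟨fun e f hef ↦ ?_, fun ⟨c, hc, hcl⟩ ↦ ?_⟩)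
  · have h1 (e) : ((p e).closeUp (hm e).2.2 (q e)).getVert s = e.1.1 := by
      simp [Walk.getVert_append, hpl]
    have h2 (e) : ((p e).closeUp (hm e).2.2 (q e)).getVert (s + 1) = e.1.2 := by
      simp [Walk.getVert_append, hpl]
    have hef := Subtype.ext_iff.1 hef
    dsimp only at hef
    exact Subtype.ext (Prod.ext (by rw [← h1 e, hef, h1]) (by rw [← h2 e, hef, h2]))
  · have hadj : G.Adj (c.getVert s) (c.getVert (s + 1)) := c.adj_getVert_succ (by lia)
    have hp' := hc.isPath_take (n := s) (by lia)
    have hq' := (hc.isPath_drop (n := s + 1) (by lia)).reverse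
    have hpl' : (c.take s).length = s := by rw [Walk.take_length]; lia
    have hql' : (c.drop (s + 1)).reverse.length = s := by
      rw [Walk.length_reverse, Walk.drop_length]; lia
    have hx := hp'.edist_eq_length (by rwa [hpl'])
    have hy := hq'.edist_eq_length (by rwa [hql'])
    rw [hpl'] at hx
    rw [hql'] at hy
    let e : G.interedges (G.distSphere u s) (G.distSphere u s) :=
      ⟨(c.getVert s, c.getVert (s + 1)), by simp [mem_interedges_iff, hx, hy, hadj]⟩
    have hpe : p e = c.take s :=
      (hp e).eq_of_length_add_lt_egirth hp' (by rwa [hpl, hpl', ← two_mul])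
    have hqe : q e = (c.drop (s + 1)).reverse :=
      (hq e).eq_of_length_add_lt_egirth hq' (by rwa [hql, hql', ← two_mul])
    refine ⟨e, Subtype.ext ?_⟩
    refine Walk.ext_getVert_le_length ?_ fun j hj ↦ ?_
    · simp [hpl, hql]; lia
    · dsimp only [Walk.closeUp]
      rw [Walk.getVert_append, hpl, hpe, hqe]
      split_ifs with hjs
      · rw [Walk.take_getVert, min_eq_right hjs.le]
      · obtain ⟨j, rfl⟩ := Nat.exists_eq_add_of_le (not_lt.1 hjs)
        rcases j with - | j
        · simp [e]
        · simp [Walk.drop_getVert, e]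
          congr 1
          lia

omit [Fintype V] in
lemma card_interedges_comm (A B : Finset V) :
    (G.interedges A B).card = (G.interedges B A).card :=
  have := G.symm
  Rel.card_interedges_comm A B

omit [Fintype V] in
lemma card_interedges_eq_sum (A B : Finset V) :
    (G.interedges A B).card = ∑ x ∈ A, (B.filter (G.Adj x)).card := by
  simp only [interedges, Rel.interedges, Finset.card_filter, Finset.sum_product]

lemma card_filter_distSphere_pred (hx : G.edist u x = (i + 1 : ℕ))
    (hg : (2 * (i + 1) : ℕ) < G.egirth) :
    ((G.distSphere u i).filter (G.Adj x)).card = 1 := by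
  obtain ⟨p, hp, hpl⟩ := exists_isPath_of_edist_eq hx
  have hnil : ¬ p.Nil := fun h ↦ by simp [Walk.length_eq_zero_iff.2 h] at hpl
  have hadj := p.adj_penultimate hnil
  have hpen : G.edist u p.penultimate = i := by
    have hl : p.dropLast.length = i := by
      simp [hpl]
    have := hp.dropLast.edist_eq_length (lt_of_le_of_lt (mod_cast by lia) hg)
    rwa [hl] at this
  rw [Finset.card_eq_one]
  refine ⟨p.penultimate, ?_⟩
  ext y
  simp only [Finset.mem_filter, mem_distSphere, Finset.mem_singleton]
  refine ⟨fun h ↦ eq_of_adj_of_edist_eq hx h.1 hpen h.2.symm hadj hg, ?_⟩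
  rintro rfl
  exact ⟨hpen, hadj.symm⟩

lemma card_filter_adj_eq_add (hx : G.edist u x = (i + 1 : ℕ)) :
    (Finset.univ.filter (G.Adj x)).card = ((G.distSphere u i).filter (G.Adj x)).card +
      ((G.distSphere u (i + 1)).filter (G.Adj x)).card +
      ((G.distSphere u (i + 2)).filter (G.Adj x)).card := by
  classical
  rw [← Finset.card_union_of_disjoint, ← Finset.card_union_of_disjoint]
  · congr 1
    ext y
    simp only [Finset.mem_filter, Finset.mem_univ, true_and, Finset.mem_union, mem_distSphere]
    refine ⟨fun h ↦ ?_, by tauto⟩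
    have h₁ := edist_le_add_one (u := u) h
    have h₂ := edist_le_add_one (u := u) h.symm
    rw [hx] at h₁ h₂
    obtain ⟨n, hn⟩ := ENat.ne_top_iff_exists.1
      (ne_top_of_le_ne_top (ENat.natCast_ne_top (i + 1 + 1)) (mod_cast h₁))
    rw [← hn] at h₁ h₂ ⊢
    norm_cast at h₁ h₂ ⊢
    have : n = i ∨ n = i + 1 ∨ n = i + 2 := by lia
    tauto
  all_goals
    rw [Finset.disjoint_left]
    intro y hy hy'
    simp only [Finset.mem_union, Finset.mem_filter, mem_distSphere] at hy hy'
    have := hy'.1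
    first
    | (rcases hy with hy | hy <;> rw [hy.1] at this <;> norm_cast at this <;> lia)
    | (rw [hy.1] at this; norm_cast at this; lia)

variable {k s : ℕ}

lemma card_distSphere (hk : ∀ x, (Finset.univ.filter (G.Adj x)).card = k)
    (hg : (2 * (i + 1) : ℕ) < G.egirth) (u : V) :
    (G.distSphere u (i + 1)).card = k * (k - 1) ^ i := by
  induction i with
  | zero =>
    rw [pow_zero, mul_one, ← hk u]
    congr 1
    ext y
    simp [edist_eq_one_iff_adj]
  | succ i ih =>
    have hg' : (2 * (i + 1) + 1 : ℕ) < G.egirth := lt_of_le_of_lt (mod_cast by lia) hg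
    have ih := ih (lt_of_le_of_lt (mod_cast by lia) hg')
    have hup : (G.interedges (G.distSphere u (i + 1)) (G.distSphere u (i + 2))).card =
        (G.distSphere u (i + 1)).card * (k - 1) := by
      rw [card_interedges_eq_sum, Finset.sum_const_nat]
      intro x hx
      rw [mem_distSphere] at hx
      have h₀ : (G.distSphere u (i + 1)).filter (G.Adj x) = ∅ :=
        Finset.filter_eq_empty_iff.2 fun y hy ↦
          not_adj_of_edist_eq hx (mem_distSphere.1 hy) hg'
      have h₁ := card_filter_adj_eq_add hx
      rw [hk, card_filter_distSphere_pred hx (lt_of_le_of_lt (mod_cast by lia) hg'), h₀,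
        Finset.card_empty] at h₁
      lia
    have hdown : (G.interedges (G.distSphere u (i + 2)) (G.distSphere u (i + 1))).card =
        (G.distSphere u (i + 2)).card * 1 := by
      rw [card_interedges_eq_sum, Finset.sum_const_nat]
      exact fun x hx ↦ card_filter_distSphere_pred (mem_distSphere.1 hx) hg
    rw [← mul_one (G.distSphere u (i + 1 + 1)).card, ← hdown, card_interedges_comm, hup, ih,
      pow_succ, mul_assoc]

variable [DecidableEq V]

lemma mem_interedges_distBall_compl :
    (x, y) ∈ G.interedges (G.distBall u i) (G.distBall u i)ᶜ ↔
      G.edist u x = i ∧ G.edist u y = (i + 1 : ℕ) ∧ G.Adj x y := by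
  rw [mem_interedges_iff, Finset.mem_compl, mem_distBall, mem_distBall, not_le]
  refine ⟨fun ⟨hx, hy, h⟩ ↦ ?_, fun ⟨hx, hy, h⟩ ↦ ⟨hx.le, by rw [hy]; norm_cast; lia, h⟩⟩
  have h₁ := edist_le_add_one (u := u) h
  obtain ⟨m, hm⟩ := ENat.ne_top_iff_exists.1 (ne_top_of_le_ne_top (ENat.natCast_ne_top i) hx)
  rw [← hm] at h₁ hx ⊢
  obtain ⟨n, hn⟩ := ENat.ne_top_iff_exists.1
    (ne_top_of_le_ne_top (ENat.natCast_ne_top (m + 1)) (mod_cast h₁))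
  rw [← hn] at h₁ hy ⊢
  norm_cast at h₁ hx hy ⊢
  exact ⟨by lia, by lia, h⟩

lemma vertexCycleCount_add_card_interedges (hs : s ≠ 0)
    (hk : ∀ x, (Finset.univ.filter (G.Adj x)).card = k) (hg : (2 * s : ℕ) < G.egirth) (u : V) :
    vertexCycleCount G (2 * s + 1) u +
      (G.interedges (G.distBall u s) (G.distBall u s)ᶜ).card = k * (k - 1) ^ s := by
  obtain ⟨i, rfl⟩ := Nat.exists_eq_succ_of_ne_zero hs
  have hcut : G.interedges (G.distBall u (i + 1)) (G.distBall u (i + 1))ᶜ =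
      G.interedges (G.distSphere u (i + 1)) (G.distSphere u (i + 2)) := by
    ext ⟨x, y⟩
    rw [mem_interedges_distBall_compl, mem_interedges_iff, mem_distSphere, mem_distSphere]
  rw [vertexCycleCount_eq_card_interedges hs hg, Nat.succ_eq_add_one, hcut, card_interedges_eq_sum,
    card_interedges_eq_sum, ← Finset.sum_add_distrib, Finset.sum_const_nat (m := k - 1),
    card_distSphere hk hg, pow_succ, mul_assoc]
  intro x hx
  rw [mem_distSphere] at hx
  have h₁ := card_filter_adj_eq_add hx
  rw [hk, card_filter_distSphere_pred hx hg] at h₁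
  lia

/-- Posimodularity of the edge boundary. -/
lemma card_interedges_sdiff_add_le (A B : Finset V) :
    (G.interedges (A \ B) (A \ B)ᶜ).card + (G.interedges (B \ A) (B \ A)ᶜ).card ≤
      (G.interedges A Aᶜ).card + (G.interedges B Bᶜ).card := by
  rw [card_interedges_comm (B \ A), card_interedges_comm B, ← Finset.card_union_add_card_inter,
    ← Finset.card_union_add_card_inter (G.interedges A Aᶜ)]
  refine add_le_add (Finset.card_le_card ?_) (Finset.card_le_card ?_)
  all_goals
    rintro ⟨x, y⟩
    simp only [Finset.mem_union, Finset.mem_inter, mem_interedges_iff, Finset.mem_sdiff,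
      Finset.mem_compl]
    tauto

/-- In a graph of minimum degree `k`, a small nonempty set of vertices has edge boundary at
least `k`. -/
lemma le_card_interedges_compl (hk : ∀ x, k ≤ (Finset.univ.filter (G.Adj x)).card) {T : Finset V}
    (hT : T.Nonempty) (hTk : T.card ≤ k) : k ≤ (G.interedges T Tᶜ).card := by
  have hlow : T.card * (k - (T.card - 1)) ≤ (G.interedges T Tᶜ).card := by
    rw [card_interedges_eq_sum, ← smul_eq_mul]
    refine Finset.card_nsmul_le_sum _ _ _ fun x hx ↦ ?_
    have hsub : Finset.univ.filter (G.Adj x) ⊆ T.erase x ∪ Tᶜ.filter (G.Adj x) := by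
      intro y
      simp only [Finset.mem_filter, Finset.mem_univ, true_and, Finset.mem_union, Finset.mem_erase,
        Finset.mem_compl]
      exact fun h ↦ or_iff_not_imp_left.2 fun h' ↦ ⟨fun hy ↦ h' ⟨h.ne', hy⟩, h⟩
    have := (Finset.card_le_card hsub).trans (Finset.card_union_le _ _)
    rw [Finset.card_erase_of_mem hx] at this
    have := hk x
    lia
  refine le_trans ?_ hlow
  obtain ⟨t, ht⟩ := Nat.exists_eq_add_of_lt hT.card_pos
  obtain ⟨r, rfl⟩ := Nat.exists_eq_add_of_le hTk
  rw [ht] at *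
  rw [show 0 + t + 1 + r - (0 + t + 1 - 1) = r + 1 by lia]
  nlinarith [Nat.zero_le (t * r)]

lemma card_distBall_sdiff_le (h : G.Adj x y) :
    (G.distBall x i \ G.distBall y i).card ≤
      (G.interedges (G.distBall y i) (G.distBall y i)ᶜ).card := by
  refine (Finset.card_le_card fun z hz ↦ ?_).trans (Finset.card_image_le (f := Prod.snd))
  rw [Finset.mem_sdiff, mem_distBall, mem_distBall, not_le] at hz
  have hle : G.edist y z ≤ (i + 1 : ℕ) := by
    rw [edist_comm, Nat.cast_add_one]
    exact (edist_le_add_one h).trans (by gcongr; rw [edist_comm]; exact hz.1)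
  have heq : G.edist y z = (i + 1 : ℕ) :=
    hle.antisymm (by rw [Nat.cast_add_one]; exact Order.add_one_le_of_lt hz.2)
  obtain ⟨p, -, hpl⟩ := exists_isPath_of_edist_eq heq
  have hnil : ¬ p.Nil := fun h ↦ by simp [Walk.length_eq_zero_iff.2 h] at hpl
  have hpen := edist_le p.dropLast
  rw [show p.dropLast.length = i by simp [hpl]] at hpen
  refine Finset.mem_image.2 ⟨(p.penultimate, z), ?_, rfl⟩
  rw [mem_interedges_iff, Finset.mem_compl, mem_distBall, mem_distBall, not_le]
  exact ⟨hpen, hz.2, p.adj_penultimate hnil⟩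

/-- In a finite graph of minimum degree `k`, some ball of radius `i` has an edge boundary that is
empty or of size at least `k`. -/
theorem exists_card_interedges_distBall_compl [Nonempty V]
    (hk : ∀ x, k ≤ (Finset.univ.filter (G.Adj x)).card) (i : ℕ) :
    ∃ u, (G.interedges (G.distBall u i) (G.distBall u i)ᶜ).card = 0 ∨
      k ≤ (G.interedges (G.distBall u i) (G.distBall u i)ᶜ).card := by
  by_contra! hcut
  obtain ⟨u, -, hu⟩ := Finset.exists_max_image (Finset.univ : Finset V)
    (fun u ↦ (G.distBall u i).card) Finset.univ_nonempty
  obtain ⟨⟨x, y⟩, hxy⟩ := Finset.card_ne_zero.1 (hcut u).1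
  obtain ⟨-, huy, -⟩ := mem_interedges_distBall_compl.1 hxy
  obtain ⟨p, -, hpl⟩ := exists_isPath_of_edist_eq huy
  have hnil : ¬ p.Nil := fun h ↦ by simp [Walk.length_eq_zero_iff.2 h] at hpl
  have hadj : G.Adj u p.snd := p.adj_snd hnil
  have hsnd := edist_le p.tail
  rw [show p.tail.length = i by have := p.length_tail_add_one hnil; lia] at hsnd
  have hy : y ∈ G.distBall p.snd i \ G.distBall u i := by
    rw [Finset.mem_sdiff, mem_distBall, mem_distBall, huy]
    exact ⟨hsnd, by norm_cast; lia⟩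
  have hne : (G.distBall u i \ G.distBall p.snd i).Nonempty := by
    rw [Finset.sdiff_nonempty]
    intro hsub
    have hlt := Finset.card_lt_card (hsub.ssubset_of_mem_notMem (Finset.mem_sdiff.1 hy).1
      (Finset.mem_sdiff.1 hy).2)
    exact hlt.not_ge (hu _ (Finset.mem_univ _))
  have h₁ := le_card_interedges_compl hk hne
    ((card_distBall_sdiff_le hadj).trans (hcut _).2.le)
  have h₂ := le_card_interedges_compl hk ⟨y, hy⟩
    ((card_distBall_sdiff_le hadj.symm).trans (hcut _).2.le)
  have h₃ := card_interedges_sdiff_add_le (G := G) (G.distBall u i) (G.distBall p.snd i)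
  have := (hcut u).2
  have := (hcut p.snd).2
  lia

end SimpleGraph

/-- for `k ≥ 3`, odd `g = 2s+1 ≥ 7`, and `0 < ε ≤ (k-1)/2`
(i.e. `2ε ≤ k-1`), there is no `vgr(n, k, g, k(k-1)^s/2 - ε)`-graph. -/
theorem no_vgr_odd_girth_near_moore (k g s eps : ℕ) (hk : 3 ≤ k)
    (hgs : g = 2 * s + 1) (hg : 7 ≤ g) (he1 : 0 < eps) (he2 : 2 * eps ≤ k - 1) :
    ¬ ∃ (n : ℕ) (V : Type) (G : SimpleGraph V),
      IsVGR G n k g (k * (k - 1) ^ s / 2 - eps) := by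
  classical
  rintro ⟨n, V, G, hfin, -, hdeg, hgirth, hcycle⟩
  have := Fintype.ofFinite V
  subst hgs
  rw [Nat.cast_inj] at hgirth
  have hacyc : ¬ G.IsAcyclic := fun h ↦ by
    have := h.girth_eq_zero
    lia
  obtain ⟨v, -⟩ := exists_girth_eq_length.2 hacyc
  have hlt : (2 * s : ℕ) < G.egirth := by
    refine lt_of_lt_of_le ?_ G.egirth.natCast_toNat_le_self
    rw [← girth, hgirth]
    exact_mod_cast Nat.lt_succ_self _
  have hreg (x) : (Finset.univ.filter (G.Adj x)).card = k := by
    rw [← hdeg x, ← Nat.card_eq_finsetCard]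
    exact Nat.card_congr (.subtypeEquivRight fun y ↦ by simp)
  have hs : s ≠ 0 := by lia
  have heven : 2 ∣ k * (k - 1) ^ s :=
    (Nat.even_mul_pred_self k).two_dvd.trans (mul_dvd_mul_left k (dvd_pow_self _ hs))
  have hlarge : 2 * eps ≤ k * (k - 1) ^ s :=
    (he2.trans (Nat.sub_le k 1)).trans (Nat.le_mul_of_pos_right k (pow_pos (by lia) s))
  have : Nonempty V := ⟨v⟩
  obtain ⟨u, hu⟩ := exists_card_interedges_distBall_compl (fun x ↦ (hreg x).ge) s
  have hcount := vertexCycleCount_add_card_interedges hs hreg hlt u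
  rw [hcycle] at hcount
  lia
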